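/- Let Q be a measure on a measurable space 𝒳, let f, g : 𝒳 → (0, +∞) be measurable with ∫ f dQ = 1 and ∫ g dQ ≤ 1, and assume it is NOT the case that f = g Q-almost everywhere. Then for every λ ∈ (0, 1), the integral ∫ f · log((λ f + (1−λ) g)/g) dQ is well defined in (−∞, +∞] (the integrand is bounded below by f · log(1−λ)) and is strictly positive. -/

import Mathlib

open MeasureTheory

/-- Let `f, g > 0` be measurable with `∫ f dQ = 1` and `∫ g dQ ≤ 1`, and
`¬(f = g Q-a.e.)`.  Then for every `λ ∈ (0,1)` the integrand
`h := f · log((λf + (1−λ)g)/g)` is bounded below by `f · log(1−λ)`, its negative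
part is `Q`-integrable (so the integral `∫ h dQ` is well defined in `(−∞,+∞]`),
and the integral is strictly positive, i.e. `∫ h⁻ dQ < ∫ h⁺ dQ`. -/
theorem statement8
    {𝒳 : Type*} [MeasurableSpace 𝒳] (Q : Measure 𝒳)
    (f g : 𝒳 → ℝ) (hfmeas : Measurable f) (hgmeas : Measurable g)
    (hfpos : ∀ x, 0 < f x) (hgpos : ∀ x, 0 < g x)
    (hf1 : (∫⁻ x, ENNReal.ofReal (f x) ∂Q) = 1)
    (hg1 : (∫⁻ x, ENNReal.ofReal (g x) ∂Q) ≤ 1)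
    (hne : ¬ (f =ᵐ[Q] g))
    (lam : ℝ) (hlam0 : 0 < lam) (hlam1 : lam < 1) :
    (∀ x, f x * Real.log (1 - lam) ≤
        f x * Real.log ((lam * f x + (1 - lam) * g x) / g x)) ∧
    (∫⁻ x, ENNReal.ofReal (-(f x * Real.log ((lam * f x + (1 - lam) * g x) / g x))) ∂Q)
      ≠ ⊤ ∧
    (∫⁻ x, ENNReal.ofReal (-(f x * Real.log ((lam * f x + (1 - lam) * g x) / g x))) ∂Q)
      < ∫⁻ x, ENNReal.ofReal (f x * Real.log ((lam * f x + (1 - lam) * g x) / g x)) ∂Q := by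
  have key : ∀ x, lam * (f x - g x) ≤
        f x * Real.log ((lam * f x + (1 - lam) * g x) / g x) ∧
      (f x ≠ g x → lam * (f x - g x) <
        f x * Real.log ((lam * f x + (1 - lam) * g x) / g x)) := by
    intro x
    have hf := hfpos x
    have hg := hgpos x
    have h1 : 0 < 1 - lam := by linarith
    have hm : 0 < lam * f x + (1 - lam) * g x := by positivity
    have hlog := Real.one_sub_inv_le_log_of_pos (div_pos hm hg)
    have hA : f x * (1 - ((lam * f x + (1 - lam) * g x) / g x)⁻¹) =
        lam * (f x - g x) + lam * (1 - lam) * (f x - g x) ^ 2 /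
          (lam * f x + (1 - lam) * g x) := by
      rw [inv_div]
      field_simp
      ring
    have hB := mul_le_mul_of_nonneg_left hlog hf.le
    rw [hA] at hB
    constructor
    · have : 0 ≤ lam * (1 - lam) * (f x - g x) ^ 2 /
          (lam * f x + (1 - lam) * g x) := by positivity
      linarith
    · intro hfg
      have h2 : f x - g x ≠ 0 := sub_ne_zero.2 hfg
      have : 0 < lam * (1 - lam) * (f x - g x) ^ 2 /
          (lam * f x + (1 - lam) * g x) := by positivity
      linarith
  have hlow : ∀ x, f x * Real.log (1 - lam) ≤
        f x * Real.log ((lam * f x + (1 - lam) * g x) / g x) := by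
    intro x
    have hf := hfpos x
    have hg := hgpos x
    refine mul_le_mul_of_nonneg_left (Real.log_le_log (by linarith) ?_) hf.le
    rw [le_div_iff₀ hg]
    have := mul_pos hlam0 hf
    linarith
  have hfi : Integrable f Q := by
    refine ⟨hfmeas.aestronglyMeasurable, ?_⟩
    rw [hasFiniteIntegral_iff_ofReal (Filter.Eventually.of_forall fun x => (hfpos x).le), hf1]
    simp
  have hgi : Integrable g Q := by
    refine ⟨hgmeas.aestronglyMeasurable, ?_⟩
    rw [hasFiniteIntegral_iff_ofReal (Filter.Eventually.of_forall fun x => (hgpos x).le)]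
    exact lt_of_le_of_lt hg1 (by simp)
  have hIf : ∫ x, f x ∂Q = 1 := by
    rw [integral_eq_lintegral_of_nonneg_ae (Filter.Eventually.of_forall fun x => (hfpos x).le)
      hfmeas.aestronglyMeasurable, hf1]
    simp
  have hIg : ∫ x, g x ∂Q ≤ 1 := by
    rw [integral_eq_lintegral_of_nonneg_ae (Filter.Eventually.of_forall fun x => (hgpos x).le)
      hgmeas.aestronglyMeasurable]
    exact ENNReal.toReal_le_of_le_ofReal zero_le_one (by simpa using hg1)
  have hhm : Measurable fun x => f x * Real.log ((lam * f x + (1 - lam) * g x) / g x) := by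
    fun_prop
  generalize hh : (fun x => f x * Real.log ((lam * f x + (1 - lam) * g x) / g x)) = h at hhm
  have hh' : ∀ x, f x * Real.log ((lam * f x + (1 - lam) * g x) / g x) = h x :=
    fun x => congrFun hh x
  simp only [hh'] at key hlow ⊢
  have hneg : (∫⁻ x, ENNReal.ofReal (-(h x)) ∂Q) ≠ ⊤ := by
    have h1 : Integrable (fun x => -(f x * Real.log (1 - lam))) Q := (hfi.mul_const _).neg
    refine ne_top_of_le_ne_top h1.lintegral_lt_top.ne (lintegral_mono fun x => ?_)
    exact ENNReal.ofReal_le_ofReal (neg_le_neg (hlow x))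
  refine ⟨hlow, hneg, ?_⟩
  by_cases hpos : (∫⁻ x, ENNReal.ofReal (h x) ∂Q) = ⊤
  · rw [hpos]
    exact lt_top_iff_ne_top.2 hneg
  have hhi : Integrable h Q := by
    refine ⟨hhm.aestronglyMeasurable, ?_⟩
    rw [hasFiniteIntegral_iff_norm]
    have : ∀ x, ENNReal.ofReal ‖h x‖ ≤ ENNReal.ofReal (h x) + ENNReal.ofReal (-(h x)) := by
      intro x
      rcases le_total 0 (h x) with h0 | h0
      · rw [Real.norm_of_nonneg h0]
        exact le_self_add
      · rw [Real.norm_of_nonpos h0]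
        exact le_add_self
    refine lt_of_le_of_lt (lintegral_mono this) ?_
    rw [lintegral_add_left hhm.ennreal_ofReal]
    exact ENNReal.add_lt_top.2 ⟨lt_top_iff_ne_top.2 hpos, lt_top_iff_ne_top.2 hneg⟩
  have hdi : Integrable (fun x => lam * (f x - g x)) Q := (hfi.sub hgi).const_mul lam
  have hstrict : ∫ x, lam * (f x - g x) ∂Q < ∫ x, h x ∂Q := by
    refine lt_of_le_of_ne (integral_mono hdi hhi fun x => (key x).1) fun heq => hne ?_
    have h0 : ∫ x, (h x - lam * (f x - g x)) ∂Q = 0 := by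
      rw [integral_sub hhi hdi, heq, sub_self]
    rw [integral_eq_zero_iff_of_nonneg (fun x => sub_nonneg.2 (key x).1) (hhi.sub hdi)] at h0
    filter_upwards [h0] with x hx
    by_contra hc
    have := (key x).2 hc
    simp only [Pi.zero_apply] at hx
    linarith
  have hd : 0 ≤ ∫ x, lam * (f x - g x) ∂Q := by
    rw [integral_const_mul, integral_sub hfi hgi, hIf]
    exact mul_nonneg hlam0.le (by linarith)
  have hlast := lt_of_le_of_lt hd hstrict
  rw [integral_eq_lintegral_pos_part_sub_lintegral_neg_part hhi, sub_pos] at hlast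
  exact (ENNReal.toReal_lt_toReal hneg hpos).1 hlast
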